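/- The reduction modulo 7 of the degree-56 polynomial f(X) of the previous statement (f = Φ_{λ₀} with λ₀ = (1,1,1,1,1,1,1)) factors in 𝔽₇[X] as a product of 8 distinct irreducible polynomials, each of degree 7; in particular the Frobenius at 7 acts on the 56 roots with cycle type (7)⁸. -/

import Mathlib

open Polynomial

set_option maxHeartbeats 2000000 in
/-- The resolvent polynomial `Φ_{λ₀}` of the `E₇` multiplicative excellent family at
`λ₀ = (1,1,1,1,1,1,1)`. -/
noncomputable def E7resolvent : Polynomial ℤ :=
    C 1 * X ^ 56 - C 1 * X ^ 55 + C 40 * X ^ 54 - C 22 * X ^ 53 + C 797 * X ^ 52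
      - C 190 * X ^ 51 + C 9878 * X ^ 50 - C 1513 * X ^ 49 + C 82195 * X ^ 48
      - C 17689 * X ^ 47 + C 496844 * X ^ 46 - C 175584 * X ^ 45 + C 2336237 * X ^ 44
      - C 1196652 * X ^ 43 + C 8957717 * X ^ 42 - C 5726683 * X ^ 41
      + C 28574146 * X ^ 40 - C 20119954 * X ^ 39 + C 75465618 * X ^ 38
      - C 53541106 * X ^ 37 + C 163074206 * X ^ 36 - C 110505921 * X ^ 35
      + C 287854250 * X ^ 34 - C 181247607 * X ^ 33 + C 420186200 * X ^ 32
      - C 243591901 * X ^ 31 + C 518626022 * X ^ 30 - C 278343633 * X ^ 29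
      + C 554315411 * X ^ 28 - C 278343633 * X ^ 27 + C 518626022 * X ^ 26
      - C 243591901 * X ^ 25 + C 420186200 * X ^ 24 - C 181247607 * X ^ 23
      + C 287854250 * X ^ 22 - C 110505921 * X ^ 21 + C 163074206 * X ^ 20
      - C 53541106 * X ^ 19 + C 75465618 * X ^ 18 - C 20119954 * X ^ 17
      + C 28574146 * X ^ 16 - C 5726683 * X ^ 15 + C 8957717 * X ^ 14
      - C 1196652 * X ^ 13 + C 2336237 * X ^ 12 - C 175584 * X ^ 11
      + C 496844 * X ^ 10 - C 17689 * X ^ 9 + C 82195 * X ^ 8 - C 1513 * X ^ 7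
      + C 9878 * X ^ 6 - C 190 * X ^ 5 + C 797 * X ^ 4 - C 22 * X ^ 3
      + C 40 * X ^ 2 - C 1 * X + C 1

namespace DensePoly

/-- The polynomial whose coefficients, from degree `0` upwards, are the entries of a list. -/
noncomputable def ofList {R : Type*} [CommRing R] : List R → R[X]
  | [] => 0
  | a :: l => C a + X * ofList l

section Arithmetic

variable {R : Type*} [CommRing R]

theorem coeff_ofList (l : List R) (i : ℕ) : (ofList l).coeff i = l.getD i 0 := by
  induction l generalizing i with
  | nil => simp [ofList]
  | cons a l ih => cases i <;> simp [ofList, ih, coeff_C]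

theorem ofList_map {S : Type*} [CommRing S] (φ : R →+* S) (l : List R) :
    (ofList l).map φ = ofList (l.map φ) := by
  induction l with
  | nil => simp [ofList]
  | cons a l ih => simp [ofList, ih]

theorem ofList_injOn_length (n : ℕ) : Set.InjOn ofList {l : List R | l.length = n} := by
  intro l hl m hm h
  refine List.ext_getElem (hl.trans hm.symm) fun i hi hi' => ?_
  simpa [coeff_ofList, hi, hi'] using congrArg (fun p : R[X] => p.coeff i) h

theorem natDegree_ofList_le {l : List R} {n : ℕ} (hl : l.length ≤ n + 1) :
    (ofList l).natDegree ≤ n := by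
  refine natDegree_le_iff_coeff_eq_zero.2 fun i hi => ?_
  rw [coeff_ofList, List.getD_eq_default _ _ (by lia)]

theorem eval_ofList (l : List R) (x : R) :
    (ofList l).eval x = l.foldr (fun a s => a + x * s) 0 := by
  induction l with
  | nil => simp [ofList]
  | cons a l ih => simp [ofList, ih]

variable [DecidableEq R]

/-- Prepend a coefficient, representing the zero polynomial by the empty list. -/
def cons (a : R) (l : List R) : List R :=
  if a = 0 ∧ l = [] then [] else a :: l

theorem ofList_cons (a : R) (l : List R) : ofList (cons a l) = C a + X * ofList l := by
  unfold cons
  split_ifs with h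
  · simp [h.1, h.2, ofList]
  · rfl

/-- The coefficients of `l + c * m`. -/
def addMul (c : R) : List R → List R → List R
  | l, [] => l
  | [], b :: m => cons (c * b) (addMul c [] m)
  | a :: l, b :: m => cons (a + c * b) (addMul c l m)

theorem ofList_addMul (c : R) (l m : List R) :
    ofList (addMul c l m) = ofList l + C c * ofList m := by
  fun_induction addMul c l m with
  | case1 => simp [ofList]
  | case2 b m ih => simp only [ofList_cons, ih, ofList, C_mul]; ring
  | case3 a l b m ih => simp only [ofList_cons, ih, ofList, C_mul, C_add]; ring

/-- The coefficients of a product. -/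
def mul : List R → List R → List R
  | [], _ => []
  | a :: l, m => addMul a (cons 0 (mul l m)) m

theorem ofList_mul (l m : List R) : ofList (mul l m) = ofList l * ofList m := by
  induction l with
  | nil => simp [mul, ofList]
  | cons a l ih => simp only [mul, ofList_addMul, ofList_cons, ih, ofList, C_0]; ring

theorem ofList_foldr_mul (L : List (List R)) :
    ofList (L.foldr mul [1]) = (L.map ofList).prod := by
  induction L with
  | nil => simp [ofList]
  | cons l L ih => simp [ofList_mul, ih]

/-- Reduction modulo a monic polynomial `q` of degree `n`. -/
def modMonic (q : List R) (n : ℕ) : List R → List R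
  | [] => []
  | a :: l =>
    let t := cons a (modMonic q n l)
    addMul (-t.getD n 0) t q

theorem dvd_sub_modMonic (q : List R) (n : ℕ) (l : List R) :
    ofList q ∣ ofList l - ofList (modMonic q n l) := by
  induction l with
  | nil => simp [modMonic]
  | cons a l ih =>
    simp only [modMonic, ofList_addMul, ofList_cons, ofList]
    generalize -(cons a (modMonic q n l)).getD n 0 = c
    convert (ih.mul_left X).sub (dvd_mul_left (ofList q) (C c)) using 1
    ring

/-- The coefficients of `f (X ^ (m + 1))`. -/
def expandList (m : ℕ) : List R → List R
  | [] => []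
  | a :: l => a :: (List.replicate m 0 ++ expandList m l)

omit [DecidableEq R] in
theorem ofList_replicate_append (m : ℕ) (l : List R) :
    ofList (List.replicate m 0 ++ l) = X ^ m * ofList l := by
  induction m with
  | zero => simp
  | succ m ih => simp [List.replicate_succ, ofList, ih, pow_succ', mul_assoc]

omit [DecidableEq R] in
theorem ofList_expandList (m : ℕ) (l : List R) :
    ofList (expandList m l) = expand R (m + 1) (ofList l) := by
  induction l with
  | nil => simp [expandList, ofList]
  | cons a l ih =>
    simp [expandList, ofList, ofList_replicate_append, ih, pow_succ', mul_assoc]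

end Arithmetic

section Frobenius

/-- The seventh power of a polynomial modulo a monic polynomial `q` of degree `n`. -/
def frobeniusMod (q : List (ZMod 7)) (n : ℕ) (l : List (ZMod 7)) : List (ZMod 7) :=
  modMonic q n (expandList 6 l)

theorem fact_prime_seven : Fact (Nat.Prime 7) := ⟨by norm_num⟩

theorem dvd_pow_sub_frobeniusMod (q : List (ZMod 7)) (n : ℕ) (l : List (ZMod 7)) :
    ofList q ∣ ofList l ^ 7 - ofList (frobeniusMod q n l) := by
  have := fact_prime_seven
  rw [← ZMod.expand_card, ← ofList_expandList 6]
  exact dvd_sub_modMonic q n _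

theorem dvd_pow_sub_iterate_frobeniusMod (q : List (ZMod 7)) (n : ℕ) (l : List (ZMod 7))
    (k : ℕ) :
    ofList q ∣ ofList l ^ 7 ^ k - ofList ((frobeniusMod q n)^[k] l) := by
  induction k with
  | zero => simp
  | succ k ih =>
    rw [Function.iterate_succ_apply', pow_succ, pow_mul]
    have h := (ih.trans (sub_dvd_pow_sub_pow _ _ 7)).add
      (dvd_pow_sub_frobeniusMod q n ((frobeniusMod q n)^[k] l))
    rwa [sub_add_sub_cancel] at h

theorem dvd_X_pow_card_pow_sub_X {q : List (ZMod 7)} {n k : ℕ}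
    (h : (frobeniusMod q n)^[k] [0, 1] = [0, 1]) :
    ofList q ∣ X ^ Nat.card (ZMod 7) ^ k - X := by
  have hX : ofList ([0, 1] : List (ZMod 7)) = X := by simp [ofList]
  have hdvd := dvd_pow_sub_iterate_frobeniusMod q n [0, 1] k
  rwa [h, hX, ← congrArg (· ^ k) (Nat.card_zmod 7)] at hdvd

end Frobenius

end DensePoly

open DensePoly

theorem irreducible_of_dvd_X_pow_card_pow_sub_X {K : Type*} [Field K] [Finite K] {f : K[X]}
    {n : ℕ} (hn : n.Prime) (hdeg : f.natDegree = n) (hdvd : f ∣ X ^ Nat.card K ^ n - X)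
    (hroot : ∀ x, f.eval x ≠ 0) : Irreducible f := by
  obtain ⟨g, hg, hgf⟩ := exists_irreducible_of_natDegree_ne_zero (hdeg ▸ hn.ne_zero)
  have hf : f ≠ 0 := by
    rintro rfl
    exact hroot 0 eval_zero
  rcases (Nat.dvd_prime hn).1
    (hg.natDegree_dvd_of_dvd_X_pow_card_pow_sub_X (hgf.trans hdvd)) with h | h
  · obtain ⟨x, hx⟩ := exists_root_of_degree_eq_one
      ((degree_eq_iff_natDegree_eq hg.ne_zero).2 h)
    exact absurd (hx.dvd hgf) (hroot x)
  · exact (associated_of_dvd_of_natDegree_le hgf hf (by lia)).irreducible hg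

/-- The coefficients of the resolvent, from degree `0` upwards. -/
def resolventCoeffs : List ℤ :=
  [1, -1, 40, -22, 797, -190, 9878, -1513, 82195, -17689, 496844, -175584, 2336237, -1196652,
    8957717, -5726683, 28574146, -20119954, 75465618, -53541106, 163074206, -110505921,
    287854250, -181247607, 420186200, -243591901, 518626022, -278343633, 554315411, -278343633,
    518626022, -243591901, 420186200, -181247607, 287854250, -110505921, 163074206, -53541106,
    75465618, -20119954, 28574146, -5726683, 8957717, -1196652, 2336237, -175584, 496844,
    -17689, 82195, -1513, 9878, -190, 797, -22, 40, -1, 1]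

theorem E7resolvent_eq_ofList : E7resolvent = ofList resolventCoeffs := by
  unfold E7resolvent resolventCoeffs
  simp only [ofList, C_neg]
  ring

/-- The coefficients of the irreducible factors of the resolvent modulo `7`. -/
def resolventFactors : List (List (ZMod 7)) :=
  [[1, 2, 1, 6, 6, 6, 2, 1],
    [1, 2, 6, 6, 6, 1, 2, 1],
    [2, 1, 1, 6, 1, 5, 6, 1],
    [2, 1, 3, 0, 6, 0, 0, 1],
    [2, 6, 3, 6, 4, 4, 6, 1],
    [4, 0, 0, 3, 0, 5, 4, 1],
    [4, 3, 2, 2, 3, 5, 3, 1],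
    [4, 3, 6, 4, 3, 4, 4, 1]]

theorem length_of_mem_resolventFactors : ∀ l ∈ resolventFactors, l.length = 8 := by
  decide +kernel

theorem foldr_mul_resolventFactors :
    resolventFactors.foldr mul [1] = resolventCoeffs.map (Int.castRingHom (ZMod 7)) := by
  decide +kernel

theorem iterate_frobeniusMod_of_mem_resolventFactors :
    ∀ l ∈ resolventFactors, (frobeniusMod l 7)^[7] [0, 1] = [0, 1] := by
  decide +kernel

theorem no_roots_of_mem_resolventFactors :
    ∀ l ∈ resolventFactors, ∀ x : ZMod 7, l.foldr (fun a s => a + x * s) 0 ≠ 0 := by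
  decide +kernel

theorem getD_seven_of_mem_resolventFactors : ∀ l ∈ resolventFactors, l.getD 7 0 = 1 := by
  decide +kernel

theorem nodup_resolventFactors : resolventFactors.Nodup := by
  decide +kernel

theorem ofList_of_mem_resolventFactors {l : List (ZMod 7)} (hl : l ∈ resolventFactors) :
    (ofList l).Monic ∧ Irreducible (ofList l) ∧ (ofList l).natDegree = 7 := by
  have := fact_prime_seven
  have hle : (ofList l).natDegree ≤ 7 :=
    natDegree_ofList_le (length_of_mem_resolventFactors l hl).le
  have hcoeff : (ofList l).coeff 7 = 1 := by
    rw [coeff_ofList, getD_seven_of_mem_resolventFactors l hl]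
  have hdeg : (ofList l).natDegree = 7 :=
    natDegree_eq_of_le_of_coeff_ne_zero hle (hcoeff ▸ one_ne_zero)
  refine ⟨monic_of_natDegree_le_of_coeff_eq_one 7 hle hcoeff,
    irreducible_of_dvd_X_pow_card_pow_sub_X (by norm_num) hdeg
      (dvd_X_pow_card_pow_sub_X (iterate_frobeniusMod_of_mem_resolventFactors l hl))
      fun x => ?_, hdeg⟩
  rw [eval_ofList]
  exact no_roots_of_mem_resolventFactors l hl x

/-- The reduction modulo `7` of the degree-56 polynomial `f = Φ_{λ₀}` factors in
`𝔽₇[X]` as a product of `8` distinct (monic) irreducible polynomials, each of degree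
`7`; in particular the Frobenius at `7` acts on the `56` roots with cycle type `(7)⁸`. -/
theorem stmt19 :
    ∃ s : Finset (Polynomial (ZMod 7)),
      s.card = 8 ∧ (∀ q ∈ s, q.Monic ∧ Irreducible q ∧ q.natDegree = 7) ∧
      E7resolvent.map (Int.castRingHom (ZMod 7)) = ∏ q ∈ s, q := by
  classical
  have hnodup : (resolventFactors.map ofList).Nodup :=
    nodup_resolventFactors.map_on fun l hl m hm h =>
      ofList_injOn_length 8 (length_of_mem_resolventFactors l hl)
        (length_of_mem_resolventFactors m hm) h
  refine ⟨(resolventFactors.map ofList).toFinset, ?_, fun q hq => ?_, ?_⟩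
  · rw [List.toFinset_card_of_nodup hnodup, List.length_map]
    rfl
  · obtain ⟨l, hl, rfl⟩ := List.mem_map.1 (List.mem_toFinset.1 hq)
    exact ofList_of_mem_resolventFactors hl
  · rw [List.prod_toFinset _ hnodup, List.map_id', ← ofList_foldr_mul,
      foldr_mul_resolventFactors, E7resolvent_eq_ofList, ofList_map]
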